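/- arXiv:1903.05762 — 4 statements merged into one kernel-verified Lean document; each statement's English description precedes it below -/
import Mathlib

section
/- Let n ≥ 1, let σ₁,…,σₙ be positive reals, let q be a nonzero real number, let f ∈ L¹(ℝⁿ;ℂ), and let y ∈ ℝⁿ. Then, as λ → −iq with λ ranging over {Re λ > 0}, the quantity (∏_{j=1}^n (λ/(2πσⱼ²))^{1/2}) · ∫_{ℝⁿ} f(y+u)·exp(−(λ/2) ∑_{j=1}^n uⱼ²/σⱼ²) du converges to (Φ_q f)(y) = (∏_{j=1}^n (−iq/(2πσⱼ²))^{1/2}) ∫_{ℝⁿ} f(u)·exp((iq/2) ∑_{j=1}^n (uⱼ−yⱼ)²/σⱼ²) du, where all square roots are principal square roots. -/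
open MeasureTheory Real Complex Filter
open scoped ENNReal NNReal Topology

/-- The finite-dimensional generalized Fourier–Feynman (Fresnel) transform
`(Φ_q f)(y) = (∏ⱼ (−iq/(2πσⱼ²))^{1/2}) ∫ f(u) exp((iq/2) ∑ (uⱼ−yⱼ)²/σⱼ²) du`,
with principal square roots. -/
noncomputable def fresnelTransform (n : ℕ) (σ : Fin n → ℝ) (q : ℝ)
    (f : (Fin n → ℝ) → ℂ) (y : Fin n → ℝ) : ℂ :=
  (∏ j, (-Complex.I * q / (2 * Real.pi * (σ j) ^ 2)) ^ ((1 : ℂ) / 2)) *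
    ∫ u : Fin n → ℝ,
      f u * Complex.exp (Complex.I * q / 2 * (∑ j, (u j - y j) ^ 2 / (σ j) ^ 2 : ℝ))

/-- For `n ≥ 1`, positive `σⱼ`, nonzero real `q`, `f ∈ L¹(ℝⁿ;ℂ)`, and `y ∈ ℝⁿ`:
as `λ → −iq` through the open right half-plane,
`(∏ⱼ (λ/(2πσⱼ²))^{1/2}) ∫ f(y+u) exp(−(λ/2) ∑ uⱼ²/σⱼ²) du` converges to
`(Φ_q f)(y)` (all principal square roots). -/
theorem fresnelTransform_exists_as_boundary_limit
    (n : ℕ) (hn : 1 ≤ n) (σ : Fin n → ℝ) (hσ : ∀ j, 0 < σ j)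
    (q : ℝ) (hq : q ≠ 0) (f : (Fin n → ℝ) → ℂ) (hf : Integrable f volume)
    (y : Fin n → ℝ) :
    Tendsto
      (fun lam : ℂ =>
        (∏ j, (lam / (2 * Real.pi * (σ j) ^ 2)) ^ ((1 : ℂ) / 2)) *
          ∫ u : Fin n → ℝ,
            f (y + u) * Complex.exp (-(lam / 2) * (∑ j, (u j) ^ 2 / (σ j) ^ 2 : ℝ)))
      (𝓝[{lam : ℂ | 0 < lam.re}] (-Complex.I * q))
      (𝓝 (fresnelTransform n σ q f y)) := by
  unfold fresnelTransform
  have hint : (∫ u : Fin n → ℝ,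
      f u * Complex.exp (Complex.I * q / 2 * (∑ j, (u j - y j) ^ 2 / (σ j) ^ 2 : ℝ))) =
      ∫ u : Fin n → ℝ,
        f (y + u) * Complex.exp (-((-Complex.I * q) / 2) * (∑ j, (u j) ^ 2 / (σ j) ^ 2 : ℝ)) := by
    rw [← integral_add_left_eq_self _ y]
    refine integral_congr_ae (Eventually.of_forall fun u => ?_)
    simp only [Pi.add_apply, add_sub_cancel_left]
    congr 2
    ring
  rw [hint]
  refine Tendsto.mul ?_ ?_
  · refine tendsto_finsetProd _ fun j _ => ?_
    have hc : (0 : ℝ) < 2 * Real.pi * (σ j) ^ 2 := by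
      have := hσ j
      positivity
    have hcc : (2 * (Real.pi : ℂ) * (σ j : ℂ) ^ 2) = ((2 * Real.pi * (σ j) ^ 2 : ℝ) : ℂ) := by
      push_cast
      ring
    have hs : (-Complex.I * q / (2 * Real.pi * (σ j) ^ 2) : ℂ) ∈ Complex.slitPlane := by
      rw [hcc, Complex.mem_slitPlane_iff]
      right
      rw [Complex.div_ofReal_im]
      simp only [neg_mul, Complex.neg_im, Complex.mul_im, Complex.I_re, Complex.I_im,
        Complex.ofReal_re, Complex.ofReal_im]
      refine div_ne_zero ?_ hc.ne'
      simpa using hq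
    have hcont : ContinuousAt
        (fun lam : ℂ => (lam / (2 * Real.pi * (σ j) ^ 2)) ^ ((1 : ℂ) / 2)) (-Complex.I * q) :=
      ContinuousAt.cpow (by fun_prop) continuousAt_const hs
    exact hcont.tendsto.mono_left nhdsWithin_le_nhds
  · have hfy : Integrable (fun u => f (y + u)) volume := hf.comp_add_left y
    refine tendsto_integral_filter_of_dominated_convergence (fun u => ‖f (y + u)‖) ?_ ?_
      hfy.norm ?_
    · refine Eventually.of_forall fun lam => ?_
      exact hfy.aestronglyMeasurable.mul (Continuous.aestronglyMeasurable (by fun_prop))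
    · filter_upwards [self_mem_nhdsWithin] with lam hlam
      refine Eventually.of_forall fun u => ?_
      rw [norm_mul]
      refine mul_le_of_le_one_right (norm_nonneg _) ?_
      rw [Complex.norm_exp, Real.exp_le_one_iff, Complex.re_mul_ofReal]
      have h1 : 0 ≤ ∑ j, (u j) ^ 2 / (σ j) ^ 2 := Finset.sum_nonneg fun j _ => by positivity
      have h2 : (-(lam / 2)).re ≤ 0 := by
        have : 0 < lam.re := hlam
        simp
        linarith
      exact mul_nonpos_of_nonpos_of_nonneg h2 h1
    · refine Eventually.of_forall fun u => ?_
      have hcont : Continuous (fun lam : ℂ =>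
          f (y + u) * Complex.exp (-(lam / 2) * (∑ j, (u j) ^ 2 / (σ j) ^ 2 : ℝ))) := by
        fun_prop
      exact hcont.continuousAt.tendsto.mono_left nhdsWithin_le_nhds
end

section
/- Let n ≥ 1, let σ₁,…,σₙ be positive reals, let q be a nonzero real number, and let f : ℝⁿ → ℂ be continuously differentiable with f ∈ L¹(ℝⁿ) and ∂ⱼf ∈ L¹(ℝⁿ) for every j = 1,…,n. Then Φ_q f is continuously differentiable on ℝⁿ and, for each j and every y ∈ ℝⁿ, ∂ⱼ(Φ_q f)(y) = (Φ_q(∂ⱼ f))(y). -/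
open MeasureTheory Real Complex Filter
open scoped ENNReal NNReal Topology

section aux
variable {n : ℕ}

lemma aux_integrable_mul {K : (Fin n → ℝ) → ℂ} (hK : Continuous K) (hK1 : ∀ w, ‖K w‖ ≤ 1)
    {F : Type*} [NormedAddCommGroup F] [NormedSpace ℂ F]
    {g : (Fin n → ℝ) → F} (hg : Integrable g volume) (y : Fin n → ℝ) :
    Integrable (fun u => K (u - y) • g u) volume := by
  refine Integrable.bdd_smul (φ := fun u => K (u - y)) hg 1 ?_ ?_
  · exact (hK.comp (continuous_id.sub continuous_const)).aestronglyMeasurable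
  · exact Filter.Eventually.of_forall fun u => hK1 _

lemma aux_continuous {K : (Fin n → ℝ) → ℂ} (hK : Continuous K) (hK1 : ∀ w, ‖K w‖ ≤ 1)
    {F : Type*} [NormedAddCommGroup F] [NormedSpace ℂ F]
    {g : (Fin n → ℝ) → F} (hg : Integrable g volume) :
    Continuous (fun y => ∫ u, K (u - y) • g u) := by
  refine continuous_of_dominated (bound := fun u => ‖g u‖) ?_ ?_ hg.norm ?_
  · intro y
    exact (aux_integrable_mul hK hK1 hg y).aestronglyMeasurable
  · intro y
    refine Filter.Eventually.of_forall fun u => ?_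
    rw [norm_smul]
    exact mul_le_of_le_one_left (norm_nonneg _) (hK1 _)
  · refine Filter.Eventually.of_forall fun u => ?_
    exact (hK.comp (continuous_const.sub continuous_id)).smul continuous_const

lemma aux_shift {K : (Fin n → ℝ) → ℂ} 
    {F : Type*} [NormedAddCommGroup F] [NormedSpace ℂ F]
    (g : (Fin n → ℝ) → F) (y : Fin n → ℝ) :
    ∫ u, K (u - y) • g u = ∫ w, K w • g (w + y) := by
  rw [← integral_add_right_eq_self (fun u => K (u - y) • g u) y]
  simp

lemma aux_ftc {K : (Fin n → ℝ) → ℂ} (hK : Continuous K) (hK1 : ∀ w, ‖K w‖ ≤ 1)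
    {f : (Fin n → ℝ) → ℂ} (hf : ContDiff ℝ 1 f) (hf1 : Integrable f volume)
    (hd : Integrable (fderiv ℝ f) volume) (y v : Fin n → ℝ) :
    (∫ u, K (u - (y + v)) • f u) - (∫ u, K (u - y) • f u) =
      ∫ s in (0:ℝ)..1, ∫ u, K (u - (y + s • v)) • fderiv ℝ f u v := by
  have hdv : Integrable (fun u => fderiv ℝ f u v) volume := hd.apply_continuousLinearMap v
  have hcd : Continuous (fun u => fderiv ℝ f u v) :=
    (hf.continuous_fderiv one_ne_zero).clm_apply continuous_const
  have hsh : ∀ z : Fin n → ℝ, Integrable (fun w => K w • fderiv ℝ f (w + z) v) volume := by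
    intro z
    have := (aux_integrable_mul hK hK1 hdv z).comp_add_right z
    simpa using this
  have hsf : ∀ z : Fin n → ℝ, Integrable (fun w => K w • f (w + z)) volume := by
    intro z
    have := (aux_integrable_mul hK hK1 hf1 z).comp_add_right z
    simpa using this
  have hprod : Integrable (Function.uncurry fun (s : ℝ) (w : Fin n → ℝ) =>
      K w • fderiv ℝ f (w + (y + s • v)) v)
      ((volume.restrict (Set.Ioc (0:ℝ) 1)).prod volume) := by
    have hmeas : AEStronglyMeasurable (Function.uncurry fun (s : ℝ) (w : Fin n → ℝ) =>
      K w • fderiv ℝ f (w + (y + s • v)) v)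
      ((volume.restrict (Set.Ioc (0:ℝ) 1)).prod volume) := by
      apply Continuous.aestronglyMeasurable
      have h1 : Continuous fun p : ℝ × (Fin n → ℝ) => p.2 + (y + p.1 • v) := by fun_prop
      have h2 : Continuous fun p : ℝ × (Fin n → ℝ) => fderiv ℝ f (p.2 + (y + p.1 • v)) v :=
        hcd.comp h1
      have h3 : Continuous fun p : ℝ × (Fin n → ℝ) => K p.2 := hK.comp continuous_snd
      exact h3.smul h2
    rw [integrable_prod_iff hmeas]
    refine ⟨Filter.Eventually.of_forall fun s => hsh (y + s • v), ?_⟩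
    have hle : ∀ s : ℝ, ‖∫ w, ‖K w • fderiv ℝ f (w + (y + s • v)) v‖‖
        ≤ ∫ w, ‖fderiv ℝ f w v‖ := by
      intro s
      rw [Real.norm_of_nonneg (integral_nonneg fun _ => norm_nonneg _),
        ← integral_add_right_eq_self (fun w => ‖fderiv ℝ f w v‖) (y + s • v)]
      refine integral_mono (hsh (y + s • v)).norm
        (hdv.norm.comp_add_right (y + s • v)) fun w => ?_
      simp only [norm_smul]
      exact mul_le_of_le_one_left (norm_nonneg _) (hK1 _)
    refine Integrable.of_bound hmeas.norm.integral_prod_right' (∫ w, ‖fderiv ℝ f w v‖) ?_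
    exact Filter.Eventually.of_forall hle
  simp only [aux_shift]
  rw [intervalIntegral.integral_of_le zero_le_one, integral_integral_swap hprod,
    ← integral_sub (hsf (y + v)) (hsf y)]
  congr 1
  ext w
  rw [integral_smul, ← intervalIntegral.integral_of_le zero_le_one, ← smul_sub]
  congr 1
  have hder : ∀ s ∈ Set.uIcc (0:ℝ) 1, HasDerivAt (fun s : ℝ => f (w + (y + s • v)))
      (fderiv ℝ f (w + (y + s • v)) v) s := by
    intro s _
    have h1 : HasDerivAt (fun s : ℝ => w + (y + s • v)) v s := by
      have := (((hasDerivAt_id s).smul_const v).const_add y).const_add w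
      simpa using this
    exact ((hf.differentiable one_ne_zero) _).hasFDerivAt.comp_hasDerivAt s h1
  rw [intervalIntegral.integral_eq_sub_of_hasDerivAt hder]
  · simp
  · apply Continuous.intervalIntegrable
    exact hcd.comp (by fun_prop)

lemma aux_hasFDerivAt {K : (Fin n → ℝ) → ℂ} (hK : Continuous K) (hK1 : ∀ w, ‖K w‖ ≤ 1)
    {f : (Fin n → ℝ) → ℂ} (hf : ContDiff ℝ 1 f) (hf1 : Integrable f volume)
    (hd : Integrable (fderiv ℝ f) volume) (y : Fin n → ℝ) :
    HasFDerivAt (fun y => ∫ u, K (u - y) • f u) (∫ u, K (u - y) • fderiv ℝ f u) y := by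
  set D : (Fin n → ℝ) → ((Fin n → ℝ) →L[ℝ] ℂ) := fun y => ∫ u, K (u - y) • fderiv ℝ f u with hD
  have hDc : Continuous D := aux_continuous hK hK1 hd
  have happ : ∀ z v, ∫ u, K (u - z) • fderiv ℝ f u v = D z v := by
    intro z v
    rw [hD, ContinuousLinearMap.integral_apply (aux_integrable_mul hK hK1 hd z)]
    rfl
  rw [hasFDerivAt_iff_isLittleO_nhds_zero, Asymptotics.isLittleO_iff]
  intro ε hε
  obtain ⟨δ, hδ, hball⟩ := Metric.continuousAt_iff.1 (hDc.continuousAt (x := y)) ε hε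
  filter_upwards [Metric.ball_mem_nhds (0 : Fin n → ℝ) hδ] with v hv
  rw [aux_ftc hK hK1 hf hf1 hd]
  simp only [happ]
  have hc : Continuous fun s : ℝ => D (y + s • v) v :=
    (hDc.comp (by fun_prop)).clm_apply continuous_const
  have e : (∫ s in (0:ℝ)..1, D (y + s • v) v) - D y v
      = ∫ s in (0:ℝ)..1, (D (y + s • v) v - D y v) := by
    rw [intervalIntegral.integral_sub (hc.intervalIntegrable _ _) (by simp)]
    simp
  change ‖(∫ s in (0:ℝ)..1, D (y + s • v) v) - D y v‖ ≤ _
  rw [e]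
  have := intervalIntegral.norm_integral_le_of_norm_le_const (a := (0:ℝ)) (b := 1)
    (f := fun s => D (y + s • v) v - D y v) (C := ε * ‖v‖) ?_
  · simpa using this
  · intro s hs
    rw [Set.uIoc_of_le zero_le_one] at hs
    rw [← sub_apply]
    refine (ContinuousLinearMap.le_opNorm _ _).trans ?_
    gcongr
    rw [← dist_eq_norm]
    refine (hball ?_).le
    rw [dist_eq_norm, add_sub_cancel_left, norm_smul, Real.norm_of_nonneg hs.1.le]
    have hv' : ‖v‖ < δ := by simpa using hv
    exact (mul_le_of_le_one_left (norm_nonneg _) hs.2).trans_lt hv'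

lemma aux_integrable_fderiv {f : (Fin n → ℝ) → ℂ} (hf : ContDiff ℝ 1 f)
    (hdf1 : ∀ j : Fin n,
      Integrable (fun u : Fin n → ℝ => fderiv ℝ f u (Pi.single j 1)) volume) :
    Integrable (fderiv ℝ f) volume := by
  refine Integrable.mono' (integrable_finsetSum Finset.univ fun j _ => (hdf1 j).norm)
    (hf.continuous_fderiv one_ne_zero).aestronglyMeasurable ?_
  refine Filter.Eventually.of_forall fun u => ?_
  refine ContinuousLinearMap.opNorm_le_bound _ (Finset.sum_nonneg fun _ _ => norm_nonneg _) ?_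
  intro v
  have hv : v = ∑ j, v j • (Pi.single j 1 : Fin n → ℝ) := by
    ext i
    simp [Finset.sum_apply, Pi.single_apply]
  conv_lhs => rw [hv]
  rw [map_sum, Finset.sum_mul]
  refine norm_sum_le_of_le _ fun j _ => ?_
  rw [map_smul, norm_smul, mul_comm]
  gcongr
  exact norm_le_pi_norm v j

end aux

/-- For `n ≥ 1`, positive `σⱼ`, nonzero real `q`, and `f : ℝⁿ → ℂ` continuously
differentiable with `f ∈ L¹` and `∂ⱼf ∈ L¹` for every `j`: `Φ_q f` is continuously
differentiable and `∂ⱼ(Φ_q f) = Φ_q (∂ⱼ f)` for each `j`. -/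
theorem fresnelTransform_partial_deriv
    (n : ℕ) (hn : 1 ≤ n) (σ : Fin n → ℝ) (hσ : ∀ j, 0 < σ j)
    (q : ℝ) (hq : q ≠ 0) (f : (Fin n → ℝ) → ℂ)
    (hf : ContDiff ℝ 1 f) (hf1 : Integrable f volume)
    (hdf1 : ∀ j : Fin n,
      Integrable (fun u : Fin n → ℝ => fderiv ℝ f u (Pi.single j 1)) volume) :
    ContDiff ℝ 1 (fresnelTransform n σ q f) ∧
    ∀ (j : Fin n) (y : Fin n → ℝ),
      fderiv ℝ (fresnelTransform n σ q f) y (Pi.single j 1) =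
        fresnelTransform n σ q (fun u => fderiv ℝ f u (Pi.single j 1)) y := by
  set K : (Fin n → ℝ) → ℂ := fun w =>
    Complex.exp (Complex.I * q / 2 * (∑ j, (w j) ^ 2 / (σ j) ^ 2 : ℝ)) with hKdef
  have hK : Continuous K := by
    apply Complex.continuous_exp.comp
    refine continuous_const.mul (Complex.continuous_ofReal.comp ?_)
    exact continuous_finsetSum _ fun j _ => ((continuous_apply j).pow 2).div_const _
  have hK1 : ∀ w, ‖K w‖ ≤ 1 := by
    intro w
    rw [hKdef]
    dsimp only
    have : Complex.I * q / 2 * ((∑ j, (w j) ^ 2 / (σ j) ^ 2 : ℝ) : ℂ)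
        = ((q / 2 * ∑ j, (w j) ^ 2 / (σ j) ^ 2 : ℝ) : ℂ) * Complex.I := by
      push_cast
      ring
    rw [this, Complex.norm_exp_ofReal_mul_I]
  have hT : ∀ g : (Fin n → ℝ) → ℂ, fresnelTransform n σ q g = fun y =>
      (∏ j, (-Complex.I * q / (2 * Real.pi * (σ j) ^ 2)) ^ ((1 : ℂ) / 2)) •
        ∫ u, K (u - y) • g u := by
    intro g
    ext y
    simp only [fresnelTransform, smul_eq_mul, hKdef, Pi.sub_apply]
    congr 2
    ext u
    rw [mul_comm]
  have hd := aux_integrable_fderiv hf hdf1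
  have hder : ∀ y, HasFDerivAt (fresnelTransform n σ q f)
      ((∏ j, (-Complex.I * q / (2 * Real.pi * (σ j) ^ 2)) ^ ((1 : ℂ) / 2)) •
        ∫ u, K (u - y) • fderiv ℝ f u) y := by
    intro y
    rw [hT]
    exact (aux_hasFDerivAt hK hK1 hf hf1 hd y).const_smul
      (∏ j, (-Complex.I * q / (2 * Real.pi * (σ j) ^ 2)) ^ ((1 : ℂ) / 2))
  refine ⟨?_, ?_⟩
  · rw [contDiff_one_iff_fderiv]
    refine ⟨fun y => (hder y).differentiableAt, ?_⟩
    rw [funext fun y => (hder y).fderiv]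
    exact (aux_continuous hK hK1 hd).const_smul
      (∏ j, (-Complex.I * q / (2 * Real.pi * (σ j) ^ 2)) ^ ((1 : ℂ) / 2))
  · intro j y
    rw [(hder y).fderiv, hT, smul_apply,
      ContinuousLinearMap.integral_apply (aux_integrable_mul hK hK1 hd y)]
    rfl
end

section
/- Let n ≥ 1, let σ₁,…,σₙ be positive reals, let q be a nonzero real number, let c₁,…,cₙ be real numbers, and let f, g : ℝⁿ → ℂ be continuously differentiable functions such that f·g, each ∂ⱼ(f·g) (j = 1,…,n), and each function u ↦ uⱼ·f(u)·g(u) (j = 1,…,n) are Lebesgue integrable on ℝⁿ, and such that f(u)g(u) → 0 as ‖u‖ → ∞. Then ∑_{j=1}^n cⱼ ∫_{ℝⁿ} [f(u)·∂ⱼg(u) + ∂ⱼf(u)·g(u)]·E_q(u) du = −iq ∑_{j=1}^n (cⱼ/σⱼ²) ∫_{ℝⁿ} uⱼ·f(u)·g(u)·E_q(u) du, where E_q(u) = exp((iq/2) ∑_{k=1}^n u_k²/σ_k²). -/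
open MeasureTheory Real Complex Filter
open scoped ENNReal NNReal Topology

/-- The oscillatory factor. -/
noncomputable def EqAux {n : ℕ} (σ : Fin n → ℝ) (q : ℝ) (u : Fin n → ℝ) : ℂ :=
  Complex.exp (Complex.I * q / 2 * (∑ k, (u k) ^ 2 / (σ k) ^ 2 : ℝ))

lemma EqAux_hasFDerivAt {n : ℕ} (σ : Fin n → ℝ) (q : ℝ) (u : Fin n → ℝ) :
    DifferentiableAt ℝ (EqAux σ q) u ∧ ∀ j, fderiv ℝ (EqAux σ q) u (Pi.single j 1) =
      EqAux σ q u * (Complex.I * q * ((u j / (σ j) ^ 2 : ℝ) : ℂ)) := by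
  have h1 : HasFDerivAt (fun v : Fin n → ℝ => ∑ k, (v k) ^ 2 / (σ k) ^ 2)
      (∑ k, (2 * u k / (σ k) ^ 2) • (ContinuousLinearMap.proj (R := ℝ) (φ := fun _ : Fin n => ℝ) k))
      u := by
    refine HasFDerivAt.fun_sum fun k _ => ?_
    have h0 : HasDerivAt (fun t : ℝ => t ^ 2 / (σ k) ^ 2) (2 * u k / (σ k) ^ 2) (u k) := by
      simpa using (hasDerivAt_pow 2 (u k)).div_const ((σ k) ^ 2)
    exact h0.comp_hasFDerivAt u (hasFDerivAt_apply (𝕜 := ℝ) k u)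
  have h2 := ((Complex.ofRealCLM.hasFDerivAt.comp u h1).const_mul (Complex.I * q / 2)).cexp
  have h3 : HasFDerivAt (EqAux σ q) _ u := h2
  refine ⟨h3.differentiableAt, fun j => ?_⟩
  rw [h3.fderiv]
  simp [EqAux, Pi.single_apply, Finset.sum_ite_eq]
  ring

lemma EqAux_norm {n : ℕ} (σ : Fin n → ℝ) (q : ℝ) (u : Fin n → ℝ) : ‖EqAux σ q u‖ = 1 := by
  have : Complex.I * q / 2 * ((∑ k, (u k) ^ 2 / (σ k) ^ 2 : ℝ) : ℂ) =
      ((q / 2 * ∑ k, (u k) ^ 2 / (σ k) ^ 2 : ℝ) : ℂ) * Complex.I := by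
    push_cast; ring
  rw [EqAux, this, Complex.norm_exp_ofReal_mul_I]

lemma EqAux_integrable {n : ℕ} (σ : Fin n → ℝ) (q : ℝ) {h : (Fin n → ℝ) → ℂ}
    (hh : Integrable h) : Integrable (fun u => EqAux σ q u * h u) := by
  have hc : Continuous (EqAux σ q) :=
    continuous_iff_continuousAt.2 fun u => (EqAux_hasFDerivAt σ q u).1.continuousAt
  exact hh.bdd_mul hc.aestronglyMeasurable (c := 1)
    (Eventually.of_forall fun u => (EqAux_norm σ q u).le)

/-- **Integration by parts for the generalized analytic Feynman integral,
finite-dimensional form.** For `n ≥ 1`, positive `σⱼ`, nonzero real `q`, reals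
`c₁,…,cₙ`, and continuously differentiable `f, g : ℝⁿ → ℂ` such that `f·g`, each
`∂ⱼ(f·g)`, and each `u ↦ uⱼ·f(u)·g(u)` are Lebesgue integrable and
`f(u)g(u) → 0` as `‖u‖ → ∞`:
`∑ⱼ cⱼ ∫ [f·∂ⱼg + ∂ⱼf·g]·E_q = −iq ∑ⱼ (cⱼ/σⱼ²) ∫ uⱼ·f·g·E_q`, where
`E_q(u) = exp((iq/2) ∑ u_k²/σ_k²)`. -/
theorem feynman_integration_by_parts_finite_dim
    (n : ℕ) (hn : 1 ≤ n) (σ : Fin n → ℝ) (hσ : ∀ j, 0 < σ j)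
    (q : ℝ) (hq : q ≠ 0) (c : Fin n → ℝ)
    (f g : (Fin n → ℝ) → ℂ) (hf : ContDiff ℝ 1 f) (hg : ContDiff ℝ 1 g)
    (hfg1 : Integrable (fun u : Fin n → ℝ => f u * g u) volume)
    (hdfg1 : ∀ j : Fin n,
      Integrable (fun u : Fin n → ℝ => fderiv ℝ (fun v => f v * g v) u (Pi.single j 1))
        volume)
    (hufg1 : ∀ j : Fin n,
      Integrable (fun u : Fin n → ℝ => (u j : ℂ) * (f u * g u)) volume)
    (hfg0 : Tendsto (fun u : Fin n → ℝ => f u * g u) (cocompact (Fin n → ℝ)) (𝓝 0)) :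
    ∑ j, (c j : ℂ) *
        ∫ u : Fin n → ℝ,
          (f u * fderiv ℝ g u (Pi.single j 1) + fderiv ℝ f u (Pi.single j 1) * g u) *
            Complex.exp (Complex.I * q / 2 * (∑ k, (u k) ^ 2 / (σ k) ^ 2 : ℝ)) =
      -(Complex.I * q) *
        ∑ j, ((c j / (σ j) ^ 2 : ℝ) : ℂ) *
          ∫ u : Fin n → ℝ,
            (u j : ℂ) * f u * g u *
              Complex.exp (Complex.I * q / 2 * (∑ k, (u k) ^ 2 / (σ k) ^ 2 : ℝ)) := by
  have key : ∀ j : Fin n,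
      (∫ u : Fin n → ℝ,
        (f u * fderiv ℝ g u (Pi.single j 1) + fderiv ℝ f u (Pi.single j 1) * g u) * EqAux σ q u) =
      -(Complex.I * q) * (((1 / (σ j) ^ 2 : ℝ) : ℂ) *
        ∫ u : Fin n → ℝ, (u j : ℂ) * f u * g u * EqAux σ q u) := by
    intro j
    have hfd : Differentiable ℝ f := hf.differentiable (by simp)
    have hgd : Differentiable ℝ g := hg.differentiable (by simp)
    have e : ∀ u, fderiv ℝ (EqAux σ q) u (Pi.single j 1) * (f u * g u) =
        (Complex.I * q * ((1 / (σ j) ^ 2 : ℝ) : ℂ)) *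
          (EqAux σ q u * ((u j : ℂ) * (f u * g u))) := by
      intro u
      rw [(EqAux_hasFDerivAt σ q u).2 j]
      push_cast
      ring
    have ibp := integral_mul_fderiv_eq_neg_fderiv_mul_of_integrable (μ := volume)
      (f := EqAux σ q) (g := fun v => f v * g v) (v := Pi.single j 1)
      (by simp_rw [e]; exact (EqAux_integrable σ q (hufg1 j)).const_mul _)
      (EqAux_integrable σ q (hdfg1 j)) (EqAux_integrable σ q hfg1)
      (fun u _ => (EqAux_hasFDerivAt σ q u).1) (fun u _ => (hfd u).mul (hgd u))
    simp_rw [e] at ibp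
    rw [integral_const_mul] at ibp
    calc _ = ∫ u, EqAux σ q u * fderiv ℝ (fun v => f v * g v) u (Pi.single j 1) := by
          congr 1; ext u
          rw [fderiv_fun_mul (hfd u) (hgd u)]
          simp
          ring
      _ = _ := by
          rw [ibp, ← mul_assoc, ← neg_mul, ← neg_mul]
          congr 2; ext u; ring
  simp only [EqAux] at key
  rw [Finset.mul_sum]
  refine Finset.sum_congr rfl fun j _ => ?_
  rw [key j]
  push_cast
  ring
end

section
/- Let n ≥ 1, let σ₁,…,σₙ be positive reals, let q be a nonzero real number, and let f : ℝⁿ → ℂ be continuously differentiable with f ∈ L¹(ℝⁿ) and ∂ⱼf ∈ L¹(ℝⁿ) for every j = 1,…,n. Then for every y ∈ ℝⁿ and every b ∈ ℝⁿ, the function μ ↦ (Φ_q f)(y + μb) is differentiable at μ = 0 and its derivative at 0 equals ∑_{j=1}^n bⱼ·(Φ_q(∂ⱼ f))(y), which is the value at y of the transform Φ_q applied to the function u ↦ ∑_{j=1}^n bⱼ·∂ⱼf(u). -/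
open MeasureTheory Real Complex Filter
open scoped ENNReal NNReal Topology

/-- The oscillating Fresnel kernel. -/
noncomputable def fresnelKer (n : ℕ) (σ : Fin n → ℝ) (q : ℝ) (w : Fin n → ℝ) : ℂ :=
  Complex.exp (Complex.I * q / 2 * (∑ j, (w j) ^ 2 / (σ j) ^ 2 : ℝ))

theorem fresnelKer_norm (n : ℕ) (σ : Fin n → ℝ) (q : ℝ) (w : Fin n → ℝ) :
    ‖fresnelKer n σ q w‖ = 1 := by
  unfold fresnelKer
  have : Complex.I * q / 2 * (∑ j, (w j) ^ 2 / (σ j) ^ 2 : ℝ)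
      = ((q / 2 * (∑ j, (w j) ^ 2 / (σ j) ^ 2) : ℝ) : ℂ) * Complex.I := by
    push_cast; ring
  rw [this, Complex.norm_exp_ofReal_mul_I]

theorem fresnelKer_continuous (n : ℕ) (σ : Fin n → ℝ) (q : ℝ) :
    Continuous (fresnelKer n σ q) := by
  unfold fresnelKer
  have : Continuous fun w : Fin n → ℝ => ∑ j, (w j) ^ 2 / (σ j) ^ 2 := by
    refine continuous_finsetSum _ fun j _ => ?_
    exact ((continuous_apply j).pow 2).div_const _
  exact Complex.continuous_exp.comp (continuous_const.mul (Complex.continuous_ofReal.comp this))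

theorem integrable_mul_ker {n : ℕ} (k : (Fin n → ℝ) → ℂ) (hk : Continuous k)
    (hk1 : ∀ w, ‖k w‖ = 1) (g : (Fin n → ℝ) → ℂ) (hg : Integrable g) :
    Integrable fun u => g u * k u :=
  hg.mul_bdd (c := 1) hk.aestronglyMeasurable (Eventually.of_forall fun w => (hk1 w).le)

theorem hasDerivAt_convolution {n : ℕ} (k : (Fin n → ℝ) → ℂ) (hk : Continuous k)
    (hk1 : ∀ w, ‖k w‖ = 1) (f : (Fin n → ℝ) → ℂ) (hf : ContDiff ℝ 1 f) (hf1 : Integrable f)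
    (y b : Fin n → ℝ) (hg1 : Integrable fun u => fderiv ℝ f u b) :
    HasDerivAt (fun μ : ℝ => ∫ u, f u * k (u - (y + μ • b)))
      (∫ u, fderiv ℝ f u b * k (u - y)) 0 := by
  set g : (Fin n → ℝ) → ℂ := fun u => fderiv ℝ f u b with hg
  have hgc : Continuous g := (hf.continuous_fderiv (by norm_num)).clm_apply continuous_const
  have shift : ∀ (h : (Fin n → ℝ) → ℂ) (s : ℝ),
      ∫ u, h u * k (u - (y + s • b)) = ∫ u, h (u + s • b) * k (u - y) := by
    intro h s
    rw [← integral_add_right_eq_self (fun u => h u * k (u - (y + s • b))) (s • b)]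
    congr 1; ext u; congr 2; abel
  set G : ℝ → ℂ := fun s => ∫ u, g u * k (u - (y + s • b)) with hG
  have hGc : Continuous G := by
    refine continuous_of_dominated (bound := fun u => ‖g u‖) ?_ ?_ hg1.norm ?_
    · intro s
      exact (hgc.mul (hk.comp (by fun_prop))).aestronglyMeasurable
    · intro s
      exact Eventually.of_forall fun u => by rw [norm_mul, hk1, mul_one]
    · exact Eventually.of_forall fun u => continuous_const.mul (hk.comp (by fun_prop))
  have hky : Continuous fun u => k (u - y) := hk.comp (by fun_prop)
  have ftc : ∀ (μ : ℝ) (u : Fin n → ℝ),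
      ∫ s in (0:ℝ)..μ, g (u + s • b) = f (u + μ • b) - f u := by
    intro μ u
    have := intervalIntegral.integral_eq_sub_of_hasDerivAt (a := 0) (b := μ)
      (f := fun s : ℝ => f (u + s • b)) (f' := fun s => g (u + s • b)) ?_ ?_
    · simpa using this
    · intro s _
      have h1 : HasDerivAt (fun s : ℝ => u + s • b) b s := by
        simpa using ((hasDerivAt_id s).smul_const b).const_add u
      exact ((hf.differentiable (by norm_num)) (u + s • b)).hasFDerivAt.comp_hasDerivAt s h1
    · exact (hgc.comp (by fun_prop)).intervalIntegrable _ _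
  have hprod : ∀ μ : ℝ, Integrable
      (fun p : ℝ × (Fin n → ℝ) => g (p.2 + p.1 • b) * k (p.2 - y))
      ((volume.restrict (Set.uIoc 0 μ)).prod volume) := by
    intro μ
    have hc : Continuous (fun p : ℝ × (Fin n → ℝ) => g (p.2 + p.1 • b) * k (p.2 - y)) :=
      (hgc.comp (by fun_prop)).mul (hk.comp (by fun_prop))
    rw [integrable_prod_iff hc.aestronglyMeasurable]
    refine ⟨Eventually.of_forall fun s => ?_, ?_⟩
    · exact integrable_mul_ker (fun u => k (u - y)) hky (fun _ => hk1 _) _ (hg1.comp_add_right (s • b))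
    · have : (fun s : ℝ => ∫ u, ‖g (u + s • b) * k (u - y)‖) = fun _ => ∫ u, ‖g u‖ := by
        ext s
        simp only [norm_mul, hk1, mul_one]
        exact integral_add_right_eq_self (fun u => ‖g u‖) (s • b)
      simp only [this]
      have : IsFiniteMeasure (volume.restrict (Set.uIoc 0 μ)) := by
        unfold Set.uIoc; infer_instance
      exact integrable_const _
  have key : ∀ μ : ℝ, ∫ u, f u * k (u - (y + μ • b))
      = (∫ u, f u * k (u - y)) + ∫ s in (0:ℝ)..μ, G s := by
    intro μ
    have h1 : ∫ s in (0:ℝ)..μ, G s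
        = ∫ u, ∫ s in (0:ℝ)..μ, g (u + s • b) * k (u - y) := by
      simp only [hG, shift g]
      exact intervalIntegral_integral_swap (hprod μ)
    rw [h1, shift f]
    simp only [intervalIntegral.integral_mul_const, ftc, sub_mul]
    rw [integral_sub]
    · ring
    · exact integrable_mul_ker (fun u => k (u - y)) hky (fun _ => hk1 _) _ (hf1.comp_add_right _)
    · exact integrable_mul_ker (fun u => k (u - y)) hky (fun _ => hk1 _) _ hf1
  simp only [key]
  have h2 := (hGc.integral_hasStrictDerivAt 0 0).hasDerivAt.const_add (∫ u, f u * k (u - y))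
  simpa [hG] using h2

/-- **Transform of the variation equals variation of the transform,
finite-dimensional form.** For `n ≥ 1`, positive `σⱼ`, nonzero real `q`, and
`f : ℝⁿ → ℂ` continuously differentiable with `f ∈ L¹` and each `∂ⱼf ∈ L¹`:
for every `y, b ∈ ℝⁿ` the map `μ ↦ (Φ_q f)(y + μb)` is differentiable at `0` with
derivative `∑ⱼ bⱼ·(Φ_q(∂ⱼf))(y)`, which equals `Φ_q(∑ⱼ bⱼ·∂ⱼf)(y)`. -/
theorem fresnelTransform_first_variation
    (n : ℕ) (hn : 1 ≤ n) (σ : Fin n → ℝ) (hσ : ∀ j, 0 < σ j)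
    (q : ℝ) (hq : q ≠ 0) (f : (Fin n → ℝ) → ℂ)
    (hf : ContDiff ℝ 1 f) (hf1 : Integrable f volume)
    (hdf1 : ∀ j : Fin n,
      Integrable (fun u : Fin n → ℝ => fderiv ℝ f u (Pi.single j 1)) volume)
    (y b : Fin n → ℝ) :
    HasDerivAt (fun μ : ℝ => fresnelTransform n σ q f (y + μ • b))
        (∑ j, (b j : ℂ) *
          fresnelTransform n σ q (fun u => fderiv ℝ f u (Pi.single j 1)) y) 0 ∧
    ∑ j, (b j : ℂ) *
        fresnelTransform n σ q (fun u => fderiv ℝ f u (Pi.single j 1)) y =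
      fresnelTransform n σ q
        (fun u => ∑ j, (b j : ℂ) * fderiv ℝ f u (Pi.single j 1)) y := by
  have hT : ∀ (h : (Fin n → ℝ) → ℂ) (z : Fin n → ℝ), fresnelTransform n σ q h z =
      (∏ j, (-Complex.I * q / (2 * Real.pi * (σ j) ^ 2)) ^ ((1 : ℂ) / 2)) *
        ∫ u, h u * fresnelKer n σ q (u - z) := fun _ _ => rfl
  have hk := fresnelKer_continuous n σ q
  have hk1 := fresnelKer_norm n σ q
  have hb : ∀ u, fderiv ℝ f u b = ∑ j, (b j : ℂ) * fderiv ℝ f u (Pi.single j 1) := by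
    intro u
    conv_lhs => rw [pi_eq_sum_univ' b]
    rw [map_sum]
    refine Finset.sum_congr rfl fun j _ => ?_
    rw [map_smul, Complex.real_smul]
  have hsum : ∑ j, (b j : ℂ) *
        fresnelTransform n σ q (fun u => fderiv ℝ f u (Pi.single j 1)) y =
      fresnelTransform n σ q
        (fun u => ∑ j, (b j : ℂ) * fderiv ℝ f u (Pi.single j 1)) y := by
    simp only [hT, Finset.sum_mul]
    rw [integral_finsetSum, Finset.mul_sum]
    · refine Finset.sum_congr rfl fun j _ => ?_
      simp only [mul_assoc, integral_const_mul]
      ring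
    · intro j _
      exact integrable_mul_ker (fun u => fresnelKer n σ q (u - y)) (hk.comp (by fun_prop))
        (fun _ => hk1 _) _ ((hdf1 j).const_mul _)
  refine ⟨?_, hsum⟩
  rw [hsum]
  simp only [hT, ← hb]
  refine (hasDerivAt_convolution _ hk hk1 f hf hf1 y b ?_).const_mul _
  simp only [hb]
  exact integrable_finsetSum _ fun j _ => (hdf1 j).const_mul _
end
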